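/- Case 21 of Theorem 1.2 (a ℚ-rank one case): the hypergeometric group Γ(f,g) generated by the companion matrices A and B of f(x) = x^5 - x^4 - x^3 + x^2 + x - 1 and g(x) = x^5 + 2x^4 + 3x^3 + 3x^2 + 2x + 1 is an arithmetic subgroup of the integral orthogonal group O_Q(ℤ): Γ(f,g) is contained in O_Q(ℤ) (in particular Aᵀ·Q·A = Q and Bᵀ·Q·B = Q), and Γ(f,g) has finite index in O_Q(ℤ). -/

import Mathlib

open Matrix

/-- The companion matrix `A` of `f(x) = x^5 - x^4 - x^3 + x^2 + x - 1`. -/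
def matA : Matrix (Fin 5) (Fin 5) ℤ :=
  !![(0 : ℤ), 0, 0, 0, 1; 1, 0, 0, 0, -1; 0, 1, 0, 0, -1; 0, 0, 1, 0, 1; 0, 0, 0, 1, 1]

/-- The companion matrix `B` of `g(x) = x^5 + 2*x^4 + 3*x^3 + 3*x^2 + 2*x + 1`. -/
def matB : Matrix (Fin 5) (Fin 5) ℤ :=
  !![(0 : ℤ), 0, 0, 0, -1; 1, 0, 0, 0, -2; 0, 1, 0, 0, -3; 0, 0, 1, 0, -3; 0, 0, 0, 1, -2]

/-- The symmetric integer matrix `Q` of the quadratic form preserved by `Γ(f,g)`. -/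
def matQ : Matrix (Fin 5) (Fin 5) ℤ :=
  !![(5 : ℤ), -5, 3, 1, -1; -5, 5, -5, 3, 1; 3, -5, 5, -5, 3; 1, 3, -5, 5, -5; -1, 1, 3, -5, 5]

/-- The integral orthogonal group `O_Q(ℤ)` of a matrix `Q`, as the subgroup of `GL₅(ℤ)`
consisting of all `M` with `Mᵀ * Q * M = Q`. -/
def orthogonalSubgroup (Q : Matrix (Fin 5) (Fin 5) ℤ) : Subgroup (GL (Fin 5) ℤ) where
  carrier := { M : GL (Fin 5) ℤ |
      (M : Matrix (Fin 5) (Fin 5) ℤ)ᵀ * Q * (M : Matrix (Fin 5) (Fin 5) ℤ) = Q }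
  one_mem' := by simp
  mul_mem' := by
    intro a b ha hb
    simp only [Set.mem_setOf_eq, Units.val_mul, transpose_mul] at ha hb ⊢
    calc ((b : Matrix (Fin 5) (Fin 5) ℤ)ᵀ * (a : Matrix (Fin 5) (Fin 5) ℤ)ᵀ) * Q *
          ((a : Matrix (Fin 5) (Fin 5) ℤ) * (b : Matrix (Fin 5) (Fin 5) ℤ))
        = (b : Matrix (Fin 5) (Fin 5) ℤ)ᵀ *
            ((a : Matrix (Fin 5) (Fin 5) ℤ)ᵀ * Q * (a : Matrix (Fin 5) (Fin 5) ℤ)) *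
            (b : Matrix (Fin 5) (Fin 5) ℤ) := by
          simp only [mul_assoc]
      _ = Q := by rw [ha, hb]
  inv_mem' := by
    intro a ha
    simp only [Set.mem_setOf_eq] at ha ⊢
    calc ((a⁻¹ : GL (Fin 5) ℤ) : Matrix (Fin 5) (Fin 5) ℤ)ᵀ * Q *
          ((a⁻¹ : GL (Fin 5) ℤ) : Matrix (Fin 5) (Fin 5) ℤ)
        = ((a⁻¹ : GL (Fin 5) ℤ) : Matrix (Fin 5) (Fin 5) ℤ)ᵀ *
            ((a : Matrix (Fin 5) (Fin 5) ℤ)ᵀ * Q * (a : Matrix (Fin 5) (Fin 5) ℤ)) *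
            ((a⁻¹ : GL (Fin 5) ℤ) : Matrix (Fin 5) (Fin 5) ℤ) := by rw [ha]
      _ = ((a : Matrix (Fin 5) (Fin 5) ℤ) *
            ((a⁻¹ : GL (Fin 5) ℤ) : Matrix (Fin 5) (Fin 5) ℤ))ᵀ * Q *
          ((a : Matrix (Fin 5) (Fin 5) ℤ) *
            ((a⁻¹ : GL (Fin 5) ℤ) : Matrix (Fin 5) (Fin 5) ℤ)) := by
          simp only [transpose_mul, mul_assoc]
      _ = Q := by rw [Units.mul_inv]; simp

/-! ### A lattice of index two and its coordinates -/

/-- Columns: a basis of the even sublattice of `ℤ⁵`, adapted to a hyperbolic splitting. -/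
def matP : Matrix (Fin 5) (Fin 5) ℤ :=
  !![0, 2, 1, 1, 1; 0, -1, 0, -1, -1; 1, -2, 0, 0, -1; 1, 2, 3, 3, 1; 0, 5, 2, 3, 2]

/-- The Gram matrix of the form in the new coordinates. -/
def matJ : Matrix (Fin 5) (Fin 5) ℤ :=
  !![0, 0, 0, 0, 1; 0, 6, 0, 0, 0; 0, 0, 6, 0, 0; 0, 0, 0, -2, 0; 1, 0, 0, 0, 0]

/-- The matrix `A` in the new coordinates. -/
def matA0 : Matrix (Fin 5) (Fin 5) ℤ :=
  !![-1, 0, 0, -2, -1; 0, 0, 1, 0, 0; 0, 2, 0, 1, 1; 1, -3, 0, 0, -1; -1, 6, 0, 2, 2]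

/-- The reflection `A⁻¹ B` in the new coordinates. -/
def matR0 : Matrix (Fin 5) (Fin 5) ℤ :=
  !![1, -60, -24, -36, -24; 0, -24, -10, -15, -10; 0, -10, -3, -6, -4; 0, 45, 18, 28, 18;
    0, 0, 0, 0, 1]

/-- Eichler transvections fixing the first basis vector. -/
def matE (s d u : ℤ) : Matrix (Fin 5) (Fin 5) ℤ :=
  !![1, -6 * s, -6 * d, 2 * u, -(3 * s ^ 2 + 3 * d ^ 2 - u ^ 2); 0, 1, 0, 0, s; 0, 0, 1, 0, d;
    0, 0, 0, 1, u; 0, 0, 0, 0, 1]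

/-- The swap of the two isotropic basis vectors. -/
def matW : Matrix (Fin 5) (Fin 5) ℤ :=
  !![0, 0, 0, 0, 1; 0, 1, 0, 0, 0; 0, 0, 1, 0, 0; 0, 0, 0, 1, 0; 1, 0, 0, 0, 0]

/-- Isometries of `matJ`. -/
def IsoJ (M : Matrix (Fin 5) (Fin 5) ℤ) : Prop := Mᵀ * matJ * M = matJ

/-- What is used about the group. -/
def Good (Γ : Subgroup (GL (Fin 5) ℤ)) : Prop :=
  (∃ a ∈ Γ, (a : Matrix (Fin 5) (Fin 5) ℤ) = matA) ∧
  (∃ b ∈ Γ, (b : Matrix (Fin 5) (Fin 5) ℤ) = matB) ∧ Γ ≤ orthogonalSubgroup matQ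

/-- `g` is the matrix of an element of `Γ` in the new coordinates. -/
def Gm (Γ : Subgroup (GL (Fin 5) ℤ)) (g : Matrix (Fin 5) (Fin 5) ℤ) : Prop :=
  ∃ γ ∈ Γ, (γ : Matrix (Fin 5) (Fin 5) ℤ) * matP = matP * g

/-- Two matrices are equivalent under left multiplication by `Γ`. -/
def GRel (Γ : Subgroup (GL (Fin 5) ℤ)) (M M' : Matrix (Fin 5) (Fin 5) ℤ) : Prop :=
  ∃ γ ∈ Γ, (γ : Matrix (Fin 5) (Fin 5) ℤ) * (matP * M) = matP * M'

lemma matP_det : matP.det = -2 := by decide +kernel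

lemma matP_cancel {M N : Matrix (Fin 5) (Fin 5) ℤ} (h : matP * M = matP * N) : M = N := by
  have h1 : matP.adjugate * (matP * M) = matP.adjugate * (matP * N) := by rw [h]
  rw [← mul_assoc, ← mul_assoc, adjugate_mul, matP_det] at h1
  ext i j
  have := congrFun (congrFun h1 i) j
  simp only [Matrix.smul_mul, one_mul, Matrix.smul_apply, smul_eq_mul] at this
  linarith

lemma matP_cancel_right {M N : Matrix (Fin 5) (Fin 5) ℤ} (h : M * matP = N * matP) : M = N := by
  have h1 : (M * matP) * matP.adjugate = (N * matP) * matP.adjugate := by rw [h]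
  rw [mul_assoc, mul_assoc, mul_adjugate, matP_det] at h1
  ext i j
  have := congrFun (congrFun h1 i) j
  simp only [Matrix.mul_smul, mul_one, Matrix.smul_apply, smul_eq_mul] at this
  linarith

lemma matP_Q : matPᵀ * matQ * matP = (2 : ℤ) • matJ := by decide +kernel

section group
variable {Γ : Subgroup (GL (Fin 5) ℤ)}

lemma GRel.refl (M) : GRel Γ M M := ⟨1, Γ.one_mem, by simp⟩

lemma GRel.trans {M N K} (h : GRel Γ M N) (h' : GRel Γ N K) : GRel Γ M K := by
  obtain ⟨a, ha, h⟩ := h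
  obtain ⟨b, hb, h'⟩ := h'
  refine ⟨b * a, Γ.mul_mem hb ha, ?_⟩
  rw [Units.val_mul, mul_assoc, h, h']

lemma GRel.mul_right {M N} (h : GRel Γ M N) (K) : GRel Γ (M * K) (N * K) := by
  obtain ⟨a, ha, h⟩ := h
  refine ⟨a, ha, ?_⟩
  rw [← mul_assoc matP, ← mul_assoc, h, mul_assoc]

lemma Gm.rel {g} (h : Gm Γ g) (M) : GRel Γ M (g * M) := by
  obtain ⟨a, ha, h⟩ := h
  exact ⟨a, ha, by rw [← mul_assoc, h, mul_assoc]⟩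

lemma Gm.one : Gm Γ 1 := ⟨1, Γ.one_mem, by simp⟩

lemma Gm.mul {g h} (hg : Gm Γ g) (hh : Gm Γ h) : Gm Γ (g * h) := by
  obtain ⟨a, ha, h1⟩ := hg
  obtain ⟨b, hb, h2⟩ := hh
  refine ⟨a * b, Γ.mul_mem ha hb, ?_⟩
  rw [Units.val_mul, mul_assoc, h2, ← mul_assoc, h1, mul_assoc]

lemma Gm.inv {g h} (hg : Gm Γ g) (hgh : g * h = 1) : Gm Γ h := by
  obtain ⟨a, ha, h1⟩ := hg
  refine ⟨a⁻¹, Γ.inv_mem ha, ?_⟩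
  have : (a : Matrix (Fin 5) (Fin 5) ℤ) * (matP * h) = matP := by
    rw [← mul_assoc, h1, mul_assoc, hgh, mul_one]
  calc ((a⁻¹ : GL (Fin 5) ℤ) : Matrix (Fin 5) (Fin 5) ℤ) * matP
      = ((a⁻¹ : GL (Fin 5) ℤ) : Matrix (Fin 5) (Fin 5) ℤ) *
        ((a : Matrix (Fin 5) (Fin 5) ℤ) * (matP * h)) := by rw [this]
    _ = matP * h := by rw [← mul_assoc, Units.inv_mul, one_mul]

lemma isoJ_of_orth {γ : GL (Fin 5) ℤ} (hγ : γ ∈ orthogonalSubgroup matQ)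
    {M M' : Matrix (Fin 5) (Fin 5) ℤ}
    (h : (γ : Matrix (Fin 5) (Fin 5) ℤ) * (matP * M) = matP * M') (hM : IsoJ M) : IsoJ M' := by
  have hγ' : (γ : Matrix (Fin 5) (Fin 5) ℤ)ᵀ * matQ * (γ : Matrix (Fin 5) (Fin 5) ℤ) = matQ := hγ
  have e1 : (matP * M')ᵀ * matQ * (matP * M') = (2 : ℤ) • (M'ᵀ * matJ * M') := by
    rw [transpose_mul]
    calc M'ᵀ * matPᵀ * matQ * (matP * M') = M'ᵀ * (matPᵀ * matQ * matP) * M' := by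
          simp only [mul_assoc]
      _ = _ := by rw [matP_Q, Matrix.mul_smul, Matrix.smul_mul]
  have e2 : (matP * M')ᵀ * matQ * (matP * M') = (2 : ℤ) • (Mᵀ * matJ * M) := by
    rw [← h, transpose_mul, transpose_mul]
    calc Mᵀ * matPᵀ * (γ : Matrix (Fin 5) (Fin 5) ℤ)ᵀ * matQ *
          ((γ : Matrix (Fin 5) (Fin 5) ℤ) * (matP * M))
        = Mᵀ * (matPᵀ * ((γ : Matrix (Fin 5) (Fin 5) ℤ)ᵀ * matQ *
          (γ : Matrix (Fin 5) (Fin 5) ℤ)) * matP) * M := by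
          simp only [mul_assoc]
      _ = _ := by rw [hγ', matP_Q, Matrix.mul_smul, Matrix.smul_mul]
  have e3 := e1.symm.trans e2
  have hM2 : Mᵀ * matJ * M = matJ := hM
  rw [hM2] at e3
  show M'ᵀ * matJ * M' = matJ
  ext i j
  have := congrFun (congrFun e3 i) j
  simp only [Matrix.smul_apply, smul_eq_mul] at this
  linarith

lemma GRel.iso (hG : Good Γ) {M N} (h : GRel Γ M N) (hM : IsoJ M) : IsoJ N := by
  obtain ⟨a, ha, h⟩ := h
  exact isoJ_of_orth (hG.2.2 ha) h hM

lemma IsoJ.mul {M N} (hM : IsoJ M) (hN : IsoJ N) : IsoJ (M * N) := by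
  unfold IsoJ at *
  rw [transpose_mul]
  calc Nᵀ * Mᵀ * matJ * (M * N) = Nᵀ * (Mᵀ * matJ * M) * N := by simp only [mul_assoc]
    _ = _ := by rw [hM, hN]

lemma IsoJ.unit {M} (hM : IsoJ M) : IsUnit M.det := by
  have h := congrArg Matrix.det hM
  rw [det_mul, det_mul, det_transpose] at h
  have hJ : matJ.det = 72 := by decide +kernel
  rw [hJ] at h
  exact IsUnit.of_mul_eq_one M.det (by linarith)

lemma IsoJ.inv {M} (hM : IsoJ M) : IsoJ M⁻¹ := by
  have h1 : M * M⁻¹ = 1 := mul_nonsing_inv M hM.unit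
  have hM2 : Mᵀ * matJ * M = matJ := hM
  show (M⁻¹)ᵀ * matJ * M⁻¹ = matJ
  calc (M⁻¹)ᵀ * matJ * M⁻¹ = (M⁻¹)ᵀ * (Mᵀ * matJ * M) * M⁻¹ := by rw [hM2]
    _ = (M * M⁻¹)ᵀ * matJ * (M * M⁻¹) := by rw [transpose_mul]; simp only [mul_assoc]
    _ = matJ := by rw [h1]; simp

/-! ### The even sublattice is preserved -/

lemma even_solve (x : Fin 5 → ℤ) (k : ℤ) (h : x 0 + x 1 + x 2 + x 3 + x 4 = 2 * k) :
    ∃ y : Fin 5 → ℤ, matP *ᵥ y = x := by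
  refine ⟨![3 * x 0 + 2 * x 2 - x 3, k - x 3, k - x 2 - x 4, k - 3 * x 0 - x 1 - x 2,
    2 * x 0 - x 1 - x 4], ?_⟩
  ext i
  fin_cases i <;> simp [matP, mulVec, dotProduct, Fin.sum_univ_five] <;> linarith

lemma orth_integral {h : GL (Fin 5) ℤ} (hh : h ∈ orthogonalSubgroup matQ) :
    ∃ g, (h : Matrix (Fin 5) (Fin 5) ℤ) * matP = matP * g ∧ IsoJ g := by
  set H := (h : Matrix (Fin 5) (Fin 5) ℤ) with hH
  have hQ : Hᵀ * matQ * H = matQ := hh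
  have hodd : ∀ i, ∃ m, H 0 i + H 1 i + H 2 i + H 3 i + H 4 i = 2 * m + 1 := by
    intro i
    have h1 := congrFun (congrFun hQ i) i
    have h2 : matQ i i = 5 := by fin_cases i <;> rfl
    rw [h2] at h1
    simp [Matrix.mul_apply, Fin.sum_univ_five, matQ] at h1
    generalize H 0 i = a at *
    generalize H 1 i = b at *
    generalize H 2 i = c at *
    generalize H 3 i = d at *
    generalize H 4 i = e at *
    have h3 : Odd (a + b + c + d + e) := by
      rw [← Int.not_even_iff_odd]
      rintro ⟨r, hr⟩
      obtain rfl : a = r + r - b - c - d - e := by linarith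
      ring_nf at h1
      omega
    obtain ⟨m, hm⟩ := h3
    exact ⟨m, by linarith⟩
  choose m hm using hodd
  have hc : ∀ j, ∃ y : Fin 5 → ℤ, matP *ᵥ y = fun i => (H * matP) i j := by
    intro j
    refine even_solve _ (∑ k, matP k j * m k + (matP 0 j + matP 1 j + matP 2 j + matP 3 j + matP 4 j) / 2) ?_
    have : (matP 0 j + matP 1 j + matP 2 j + matP 3 j + matP 4 j) = 2 * ((matP 0 j + matP 1 j + matP 2 j + matP 3 j + matP 4 j) / 2) := by
      revert j; decide +kernel
    rw [mul_add, ← this]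
    simp only [Matrix.mul_apply, Fin.sum_univ_five]
    linear_combination matP 0 j * hm 0 + matP 1 j * hm 1 + matP 2 j * hm 2 + matP 3 j * hm 3 + matP 4 j * hm 4
  choose y hy using hc
  have hg : H * matP = matP * (Matrix.of fun i j => y j i) := by
    ext i j
    have := congrFun (hy j) i
    simp only [mulVec, dotProduct] at this
    rw [← this, Matrix.mul_apply]
    simp
  refine ⟨_, hg, ?_⟩
  refine isoJ_of_orth (M := 1) hh ?_ ?_
  · simpa using hg
  · simp [IsoJ]
end group

/-! ### Words in the generators -/

/-- Action of `matA0` on coordinates. -/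
def actA : ℤ × ℤ × ℤ × ℤ × ℤ → ℤ × ℤ × ℤ × ℤ × ℤ
  | (a, s, d, u, b) => (-a - 2*u - b, d, 2*s + u + b, a - 3*s - b, -a + 6*s + 2*u + 2*b)

/-- Action of `matR0` on coordinates. -/
def actR : ℤ × ℤ × ℤ × ℤ × ℤ → ℤ × ℤ × ℤ × ℤ × ℤ
  | (a, s, d, u, b) =>
    (a - 60*s - 24*d - 36*u - 24*b, -24*s - 10*d - 15*u - 10*b,
      -10*s - 3*d - 6*u - 4*b, 45*s + 18*d + 28*u + 18*b, b)

/-- Action of the word `A^n₁ R A^n₂ R ⋯ R A^nₖ`. -/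
def runW : List ℕ → ℤ × ℤ × ℤ × ℤ × ℤ → ℤ × ℤ × ℤ × ℤ × ℤ
  | [], x => x
  | [n], x => actA^[n] x
  | n :: m :: l, x => actA^[n] (actR (runW (m :: l) x))

/-- Coordinates as a vector. -/
def vec5 : ℤ × ℤ × ℤ × ℤ × ℤ → Fin 5 → ℤ
  | (a, s, d, u, b) => ![a, s, d, u, b]

/-- The standard basis in coordinates. -/
def bas5 (j : Fin 5) : ℤ × ℤ × ℤ × ℤ × ℤ :=
  (if j = 0 then 1 else 0, if j = 1 then 1 else 0, if j = 2 then 1 else 0,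
    if j = 3 then 1 else 0, if j = 4 then 1 else 0)

lemma actA_eq (x) : vec5 (actA x) = matA0 *ᵥ vec5 x := by
  obtain ⟨a, s, d, u, b⟩ := x
  ext i
  fin_cases i <;> simp [matA0, mulVec, dotProduct, Fin.sum_univ_five, vec5, actA] <;> ring

lemma actR_eq (x) : vec5 (actR x) = matR0 *ᵥ vec5 x := by
  obtain ⟨a, s, d, u, b⟩ := x
  ext i
  fin_cases i <;> simp [matR0, mulVec, dotProduct, Fin.sum_univ_five, vec5, actR] <;> ring

section group
variable {Γ : Subgroup (GL (Fin 5) ℤ)}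

lemma Gm_A0 (hG : Good Γ) : Gm Γ matA0 := by
  obtain ⟨⟨a, ha, h⟩, -⟩ := hG
  exact ⟨a, ha, by rw [h]; decide +kernel⟩

lemma Gm_R0 (hG : Good Γ) : Gm Γ matR0 := by
  obtain ⟨⟨a, ha, h⟩, ⟨b, hb, h'⟩, -⟩ := hG
  refine ⟨a⁻¹ * b, Γ.mul_mem (Γ.inv_mem ha) hb, ?_⟩
  have e : matB * matP = matA * (matP * matR0) := by decide +kernel
  rw [Units.val_mul, mul_assoc, h', e, ← h, ← mul_assoc, Units.inv_mul, one_mul]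

lemma Gm.iter (hG : Good Γ) (n : ℕ) :
    ∃ g, Gm Γ g ∧ ∀ x, vec5 (actA^[n] x) = g *ᵥ vec5 x := by
  induction n with
  | zero => exact ⟨1, Gm.one, by simp⟩
  | succ n ih =>
    obtain ⟨g, hg, h⟩ := ih
    refine ⟨matA0 * g, (Gm_A0 hG).mul hg, fun x => ?_⟩
    rw [Function.iterate_succ_apply', actA_eq, h, mulVec_mulVec]

lemma Gm.word (hG : Good Γ) (w : List ℕ) :
    ∃ g, Gm Γ g ∧ ∀ x, vec5 (runW w x) = g *ᵥ vec5 x := by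
  induction w with
  | nil => exact ⟨1, Gm.one, by simp [runW]⟩
  | cons n l ih =>
    obtain ⟨g, hg, h⟩ := ih
    obtain ⟨g', hg', h'⟩ := Gm.iter hG n
    cases l with
    | nil => exact ⟨g', hg', fun x => h' x⟩
    | cons m l =>
      refine ⟨g' * (matR0 * g), hg'.mul ((Gm_R0 hG).mul hg), fun x => ?_⟩
      rw [runW, h', actR_eq, h, mulVec_mulVec, mulVec_mulVec, mul_assoc]

lemma bas5_vec (j : Fin 5) : vec5 (bas5 j) = Pi.single j 1 := by
  fin_cases j <;> decide +kernel

lemma Gm.of_word (hG : Good Γ) (w : List ℕ) (g : Matrix (Fin 5) (Fin 5) ℤ)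
    (h : ∀ j i, vec5 (runW w (bas5 j)) i = g i j) : Gm Γ g := by
  obtain ⟨g', hg', h'⟩ := Gm.word hG w
  have : g' = g := by
    ext i j
    rw [← h, h', bas5_vec]
    simp
  rwa [← this]

lemma matE_mul (s d u s' d' u' : ℤ) :
    matE s d u * matE s' d' u' = matE (s + s') (d + d') (u + u') := by
  ext i j
  fin_cases i <;> fin_cases j <;> simp [matE, Matrix.mul_apply, Fin.sum_univ_five] <;> ring

lemma matE_zero : matE 0 0 0 = 1 := by decide +kernel

lemma Gm.E_add {s d u s' d' u'} (h : Gm Γ (matE s d u)) (h' : Gm Γ (matE s' d' u')) :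
    Gm Γ (matE (s + s') (d + d') (u + u')) := by
  rw [← matE_mul]; exact h.mul h'

lemma Gm.E_neg {s d u} (h : Gm Γ (matE s d u)) : Gm Γ (matE (-s) (-d) (-u)) := by
  refine h.inv ?_
  rw [matE_mul, ← matE_zero]; simp

lemma Gm.E_nsmul {s d u} (h : Gm Γ (matE s d u)) (n : ℕ) :
    Gm Γ (matE (n * s) (n * d) (n * u)) := by
  induction n with
  | zero => simp [matE_zero, Gm.one]
  | succ n ih =>
    have := ih.E_add h
    convert this using 2 <;> push_cast <;> ring

lemma Gm.E_zsmul {s d u} (h : Gm Γ (matE s d u)) (n : ℤ) :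
    Gm Γ (matE (n * s) (n * d) (n * u)) := by
  rcases n.eq_nat_or_neg with ⟨m, rfl | rfl⟩
  · exact h.E_nsmul m
  · have := (h.E_nsmul m).E_neg
    simpa [neg_mul] using this

/-- The translations contained in `Γ`. -/
lemma Gm.E_lattice (hG : Good Γ) {s d u : ℤ} (h1 : 9 ∣ u) (h2 : 3 ∣ s - d) (h3 : 2 ∣ s + d + u) :
    Gm Γ (matE s d u) := by
  have a1 : Gm Γ (matE 1 1 0) :=
    Gm.of_word hG [8, 11, 11, 1, 1, 6, 10] _ (by decide +kernel)
  have a2 : Gm Γ (matE 3 0 (-9)) :=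
    Gm.of_word hG [1, 1, 6, 10, 1, 1, 10, 1, 1, 10, 7, 1, 10] _ (by decide +kernel)
  have a3 : Gm Γ (matE (-1) (-4) 9) :=
    Gm.of_word hG [3, 1, 1, 1, 2, 1, 1, 1, 2, 2, 1, 1, 1, 2, 1, 1, 1, 2, 11] _ (by decide +kernel)
  obtain ⟨k, rfl⟩ := h1
  obtain ⟨p, hp⟩ := h2
  obtain ⟨q, hq⟩ := h3
  -- `(s, d, 9 k) = x (1,1,0) + y (3,0,-9) + z (-1,-4,9)`
  obtain ⟨z, hz⟩ : ∃ z, p + k = 2 * z := ⟨q - d - p - 4 * k, by omega⟩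
  have := ((a1.E_zsmul (d + 4 * z)).E_add (a2.E_zsmul (z - k))).E_add (a3.E_zsmul z)
  convert this using 2 <;> linarith
end group

/-! ### The orbit of isotropic vectors with last coordinate `±1` -/

/-- Words reaching every class of vectors modulo translations. -/
def wordTable : List (List ℕ) :=
  [[2], [1, 10, 11, 9], [9, 11, 9], [1, 4, 10, 11, 8], [6, 10, 11, 8],
    [10, 11, 2, 1, 1], [3, 11, 11, 4, 9], [8, 1, 1, 9], [3, 2, 11, 11, 2],
    [1, 9], [11], [3, 1, 6, 1, 2], [1, 1], [3, 1, 3],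
    [7, 1, 1, 11, 9], [5, 10, 11, 8], [10, 11, 10, 4], [10, 11, 9, 11, 8],
    [3, 1, 8, 1, 1], [1, 10, 1, 1, 6], [1, 2, 1, 1], [11, 11, 10, 1, 1], [11, 11, 6, 11, 8],
    [3, 1, 2, 11, 8], [3, 1, 2, 11, 9], [11, 11, 9], [3, 11, 11, 4],
    [1, 9, 11, 10, 3], [1, 2, 1, 5, 1, 1], [4, 1, 2, 6], [5, 1, 6, 1, 1], [11, 1, 1, 6],
    [11, 11, 7], [10], [11, 11, 10, 1, 2], [1],
    [4, 1, 2, 7], [11, 10, 1, 1, 8], [1, 5, 11, 11, 1], [10, 11, 10, 3], [4, 1, 10, 11, 9],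
    [1, 7, 2, 1, 2], [9, 2, 1, 2], [5, 1, 1], [3, 1, 1],
    [11, 11, 4, 11, 9], [1, 5, 10, 11, 8], [1, 9, 11, 9, 11, 8], [11, 11, 2, 1, 1], [1, 7, 1, 1, 9],
    [6, 11, 11, 1], [3, 1, 10, 11, 9], [3, 1, 5, 1, 1], [8, 2, 1, 2]]

/-- The check for one class. -/
def chkClass (d u : ℕ) : Bool :=
  let x := runW (wordTable.getD (9 * d + u) []) (1, 0, 0, 0, 0)
  let a := x.1
  let s := x.2.1
  let e := x.2.2.1
  let v := x.2.2.2.1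
  let b := x.2.2.2.2
  (b == 1 || b == -1) && (a * b == -(3 * s ^ 2 + 3 * e ^ 2 - v ^ 2)) &&
    ((b * v - u) % 9 == 0) && ((b * s - (b * e - d)) % 3 == 0) &&
    ((b * s + (b * e - d) + (b * v - u)) % 2 == 0)

lemma chkClass_all : ∀ d : Fin 6, ∀ u : Fin 9, chkClass d u = true := by decide +kernel

section group
variable {Γ : Subgroup (GL (Fin 5) ℤ)}

/-- The last column of `matE`. -/
def ptE (s d u : ℤ) : Fin 5 → ℤ := ![-(3 * s ^ 2 + 3 * d ^ 2 - u ^ 2), s, d, u, 1]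

lemma matE_ptE (s d u s' d' u' : ℤ) :
    matE s d u *ᵥ ptE s' d' u' = ptE (s + s') (d + d') (u + u') := by
  ext i
  fin_cases i <;> simp [matE, ptE, mulVec, dotProduct, Fin.sum_univ_five] <;> ring

lemma isUnit_of_Gm {g} (hG : Good Γ) (hg : Gm Γ g) : IsUnit g.det := by
  refine IsoJ.unit ?_
  have := (hg.rel 1).iso hG (by simp [IsoJ])
  simpa using this

lemma orbit_pt (hG : Good Γ) (s d u : ℤ) :
    ∃ g, Gm Γ g ∧ ∃ ε : ℤ, (ε = 1 ∨ ε = -1) ∧ g *ᵥ ptE s d u = ![ε, 0, 0, 0, 0] := by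
  obtain ⟨u0, hu0, hu1⟩ : ∃ u0 : ℕ, u0 < 9 ∧ (u0 : ℤ) = u % 9 := ⟨(u % 9).toNat, by omega, by omega⟩
  obtain ⟨d0, hd0, hd1⟩ : ∃ d0 : ℕ, d0 < 6 ∧ (d0 : ℤ) = (d - s + 3 * (u / 9)) % 6 :=
    ⟨((d - s + 3 * (u / 9)) % 6).toNat, by omega, by omega⟩
  have hc := chkClass_all ⟨d0, hd0⟩ ⟨u0, hu0⟩
  obtain ⟨g, hg, h⟩ := Gm.word hG (wordTable.getD (9 * d0 + u0) [])
  have hx := h (1, 0, 0, 0, 0)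
  simp only [chkClass] at hc
  generalize hX : runW (wordTable.getD (9 * d0 + u0) []) (1, 0, 0, 0, 0) = X at hc hx
  obtain ⟨a, s', e, v, b⟩ := X
  simp only [Bool.and_eq_true, Bool.or_eq_true, beq_iff_eq] at hc
  obtain ⟨⟨⟨⟨hb, ha⟩, h9⟩, h3⟩, h2⟩ := hc
  have hginv : g⁻¹ * g = 1 := nonsing_inv_mul g (isUnit_of_Gm hG hg)
  have hginv' : g * g⁻¹ = 1 := mul_nonsing_inv g (isUnit_of_Gm hG hg)
  have hT : Gm Γ (matE (b * s' - s) (b * e - d) (b * v - u)) := by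
    apply Gm.E_lattice hG
    · omega
    · omega
    · omega
  refine ⟨g⁻¹ * matE (b * s' - s) (b * e - d) (b * v - u), (hg.inv hginv').mul hT, b, hb, ?_⟩
  rw [← mulVec_mulVec, matE_ptE]
  have e1 : ptE (b * s' - s + s) (b * e - d + d) (b * v - u + u) = b • vec5 (a, s', e, v, b) := by
    have hbb : b * b = 1 := by rcases hb with rfl | rfl <;> norm_num
    ext i
    fin_cases i <;> simp [ptE, vec5]
    · linear_combination (-3 * s' ^ 2 - 3 * e ^ 2 + v ^ 2) * hbb - ha
    · exact hbb.symm
  rw [e1, mulVec_smul, hx, mulVec_mulVec, hginv]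
  ext i
  fin_cases i <;> simp [vec5]
end group

/-! ### Arithmetic of the anisotropic ternary part -/

lemma three_dvd_of_sq_add {x y : ℤ} (h : 3 ∣ x ^ 2 + y ^ 2) : 3 ∣ x ∧ 3 ∣ y := by
  have hx : x % 3 = 0 ∨ x % 3 = 1 ∨ x % 3 = 2 := by omega
  have hy : y % 3 = 0 ∨ y % 3 = 1 ∨ y % 3 = 2 := by omega
  have h' : (x ^ 2 + y ^ 2) % 3 = 0 := Int.emod_eq_zero_of_dvd h
  rcases hx with hx | hx | hx <;> rcases hy with hy | hy | hy <;>
    simp [Int.add_emod, pow_two, Int.mul_emod, hx, hy] at h' <;> omega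

lemma aniso (k : ℤ) (hk : ¬ 3 ∣ k) : ∀ n : ℕ, ∀ s d u : ℤ, u.natAbs ≤ n →
    3 * (s ^ 2 + d ^ 2) = k * u ^ 2 → u = 0 := by
  have h3 : Prime (3 : ℤ) := Int.prime_three
  intro n
  induction n with
  | zero => intro s d u hu _; omega
  | succ n ih =>
    intro s d u hu h
    by_contra hne
    have hu3 : (3 : ℤ) ∣ u := by
      have : (3 : ℤ) ∣ k * u ^ 2 := ⟨_, h.symm⟩
      rcases h3.dvd_or_dvd this with h' | h'
      · exact absurd h' hk
      · exact h3.dvd_of_dvd_pow h'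
    obtain ⟨v, rfl⟩ := hu3
    have h1 : s ^ 2 + d ^ 2 = 3 * (k * v ^ 2) := by linarith
    obtain ⟨⟨s', rfl⟩, ⟨d', rfl⟩⟩ := three_dvd_of_sq_add ⟨_, h1⟩
    have := ih s' d' v (by omega) (by linarith)
    omega

lemma balanced (b : ℤ) (hb : 0 < b) (s : ℤ) : ∃ i, 2 * (s + b * i) ≤ b ∧ -b ≤ 2 * (s + b * i) := by
  have h1 := Int.emod_add_mul_ediv s b
  have h2 := Int.emod_nonneg s hb.ne'
  have h3 := Int.emod_lt_of_pos s hb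
  by_cases h : 2 * (s % b) ≤ b
  · exact ⟨-(s / b), by nlinarith, by nlinarith⟩
  · exact ⟨-(s / b) - 1, by nlinarith, by nlinarith⟩

lemma reduce_pos (b : ℤ) (hb : 0 < b) (s d u : ℤ) : ∃ i j k : ℤ,
    |3 * (s + b * i) ^ 2 + 3 * (d + b * j) ^ 2 - (u + b * k) ^ 2| < b ^ 2 := by
  obtain ⟨i, hi1, hi2⟩ := balanced b hb s
  obtain ⟨j, hj1, hj2⟩ := balanced b hb d
  obtain ⟨k, hk1, hk2⟩ := balanced b hb u
  set S := s + b * i with hS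
  set D := d + b * j with hD
  set U := u + b * k with hU
  have hS2 : 4 * S ^ 2 ≤ b ^ 2 := by nlinarith
  have hD2 : 4 * D ^ 2 ≤ b ^ 2 := by nlinarith
  have hU2 : 4 * U ^ 2 ≤ b ^ 2 := by nlinarith
  have hb2 : 0 < b ^ 2 := by positivity
  by_cases h0 : 3 * S ^ 2 + 3 * D ^ 2 - U ^ 2 < b ^ 2
  · refine ⟨i, j, k, ?_⟩
    rw [abs_lt]
    exact ⟨by nlinarith [sq_nonneg S, sq_nonneg D], h0⟩
  · -- use `|U| + b`
    push Not at h0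
    have key : ∀ V : ℤ, V ^ 2 = U ^ 2 → 0 ≤ V → 2 * V ≤ b →
        |3 * S ^ 2 + 3 * D ^ 2 - (V + b) ^ 2| < b ^ 2 := by
      intro V hV hV0 hVb
      rw [abs_lt]
      constructor
      · by_contra hcon
        push Not at hcon
        have e1 : 2 * V = b := by
          by_contra hne
          have : 2 * V < b := lt_of_le_of_ne hVb hne
          nlinarith
        subst e1
        have e2 : 3 * (S ^ 2 + D ^ 2) = 5 * V ^ 2 := by nlinarith
        have := aniso 5 (by decide) _ S D V le_rfl e2
        omega
      · nlinarith
    rcases le_total 0 U with hU0 | hU0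
    · refine ⟨i, j, k + 1, ?_⟩
      have := key U rfl hU0 hk1
      rwa [show u + b * (k + 1) = U + b by rw [hU]; ring]
    · refine ⟨i, j, k - 1, ?_⟩
      have := key (-U) (by ring) (by linarith) (by linarith)
      rw [show u + b * (k - 1) = -(-U + b) by rw [hU]; ring]
      rwa [neg_sq]

lemma reduce_any (b : ℤ) (hb : b ≠ 0) (s d u : ℤ) : ∃ i j k : ℤ,
    |3 * (s + b * i) ^ 2 + 3 * (d + b * j) ^ 2 - (u + b * k) ^ 2| < b ^ 2 := by
  rcases lt_or_gt_of_ne hb with h | h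
  · obtain ⟨i, j, k, h'⟩ := reduce_pos (-b) (by linarith) s d u
    refine ⟨-i, -j, -k, ?_⟩
    rw [neg_sq] at h'
    simpa using h'
  · exact reduce_pos b h s d u

/-! ### Euclid's algorithm: `O(ℤ)` is `Γ` times the stabiliser of the first basis line -/

lemma IsoJ.entry {M} (hM : IsoJ M) (i j : Fin 5) :
    M 0 i * M 4 j + M 4 i * M 0 j + 6 * M 1 i * M 1 j + 6 * M 2 i * M 2 j - 2 * M 3 i * M 3 j
      = matJ i j := by
  have h := congrFun (congrFun hM i) j
  rw [← h]
  simp [Matrix.mul_apply, Fin.sum_univ_five, matJ]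
  ring

/-- The first column is `±` the first basis vector. -/
def FixE (M : Matrix (Fin 5) (Fin 5) ℤ) : Prop :=
  (M 0 0 = 1 ∨ M 0 0 = -1) ∧ M 1 0 = 0 ∧ M 2 0 = 0 ∧ M 3 0 = 0 ∧ M 4 0 = 0

section group
variable {Γ : Subgroup (GL (Fin 5) ℤ)}

/-- Equivalent under `Γ` to a matrix fixing the first basis line. -/
def YY (Γ : Subgroup (GL (Fin 5) ℤ)) (M : Matrix (Fin 5) (Fin 5) ℤ) : Prop :=
  ∃ M', GRel Γ M M' ∧ FixE M'

lemma YY.E {M} (h : YY Γ M) (s d u : ℤ) : YY Γ (M * matE s d u) := by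
  obtain ⟨M', h1, h2⟩ := h
  refine ⟨_, h1.mul_right _, ?_⟩
  simpa [FixE, Matrix.mul_apply, Fin.sum_univ_five, matE] using h2

lemma FixE.last {M} (h : FixE M) (hM : IsoJ M) :
    M 4 4 = M 0 0 ∧ M 4 1 = 0 ∧ M 4 2 = 0 ∧ M 4 3 = 0 := by
  obtain ⟨h0, h1, h2, h3, h4⟩ := h
  have e1 := hM.entry 0 1
  have e2 := hM.entry 0 2
  have e3 := hM.entry 0 3
  have e4 := hM.entry 0 4
  rw [h1, h2, h3, h4] at e1 e2 e3 e4
  simp [matJ] at e1 e2 e3 e4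
  rcases h0 with h0 | h0 <;> rw [h0] at e1 e2 e3 e4 ⊢ <;> simp at e1 e2 e3 <;>
    refine ⟨by linarith, e1, e2, e3⟩

lemma YY.W (hG : Good Γ) {M} (hM : IsoJ M) (h : YY Γ M) : YY Γ (M * matW) := by
  obtain ⟨M', h1, h2⟩ := h
  have hM' : IsoJ M' := h1.iso hG hM
  obtain ⟨h44, -⟩ := h2.last hM'
  have e44 := hM'.entry 4 4
  simp [matJ] at e44
  obtain ⟨g, hg, ε, hε, hgx⟩ := orbit_pt hG (M' 4 4 * M' 1 4) (M' 4 4 * M' 2 4) (M' 4 4 * M' 3 4)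
  have hu : M' 4 4 = 1 ∨ M' 4 4 = -1 := by rw [h44]; exact h2.1
  set c := M' 4 4 with hc
  have hcc : c * c = 1 := by rcases hu with h | h <;> rw [h] <;> norm_num
  have hcol : ∀ i, M' i 4 = c * ptE (c * M' 1 4) (c * M' 2 4) (c * M' 3 4) i := by
    intro i
    fin_cases i <;> simp [ptE]
    · rcases hu with h | h <;> rw [h] at e44 ⊢ <;> linarith
    · rw [← mul_assoc, hcc, one_mul]
    · rw [← mul_assoc, hcc, one_mul]
    · rw [← mul_assoc, hcc, one_mul]
    · exact hc.symm
  refine ⟨g * (M' * matW), (h1.mul_right _).trans (hg.rel _), ?_⟩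
  have hent : ∀ i, (g * (M' * matW)) i 0 = c * (![ε, 0, 0, 0, 0] : Fin 5 → ℤ) i := by
    intro i
    rw [← hgx, Matrix.mul_apply]
    simp only [mulVec, dotProduct, Finset.mul_sum]
    refine Finset.sum_congr rfl fun k _ => ?_
    have : (M' * matW) k 0 = M' k 4 := by
      simp [Matrix.mul_apply, Fin.sum_univ_five, matW]
    rw [this, hcol k]; ring
  refine ⟨?_, ?_, ?_, ?_, ?_⟩ <;> rw [hent]
  · rcases hu with h | h <;> rcases hε with h' | h' <;> rw [h, h'] <;> simp
  all_goals simp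

lemma isoJ_W : IsoJ matW := by unfold IsoJ; decide +kernel

lemma isoJ_E (s d u : ℤ) : IsoJ (matE s d u) := by
  unfold IsoJ
  ext i j
  fin_cases i <;> fin_cases j <;>
    simp [matE, matJ, Matrix.mul_apply, Fin.sum_univ_five] <;> ring

lemma matW_mul : matW * matW = 1 := by decide +kernel

lemma euclid (hG : Good Γ) : ∀ n : ℕ, ∀ M N, M * N = 1 → IsoJ M → IsoJ N →
    (N 4 0).natAbs ≤ n → YY Γ M := by
  intro n
  induction n using Nat.strong_induction_on with
  | _ n ih =>
  intro M N hMN hM hN hn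
  have e := hN.entry 0 0
  simp [matJ] at e
  by_cases hb : N 4 0 = 0
  · rw [hb] at e
    have e3 : N 3 0 = 0 := aniso 1 (by decide) _ (N 1 0) (N 2 0) (N 3 0) le_rfl (by linarith)
    rw [e3] at e
    have e1 : N 1 0 = 0 := by nlinarith [sq_nonneg (N 1 0), sq_nonneg (N 2 0)]
    have e2 : N 2 0 = 0 := by nlinarith [sq_nonneg (N 1 0), sq_nonneg (N 2 0)]
    refine ⟨M, GRel.refl M, ?_⟩
    have hcol : ∀ i, M i 0 * N 0 0 = (1 : Matrix (Fin 5) (Fin 5) ℤ) i 0 := by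
      intro i
      rw [← hMN, Matrix.mul_apply, Fin.sum_univ_five, e1, e2, e3, hb]; ring
    have c0 := hcol 0
    simp at c0
    have hN0 : N 0 0 ≠ 0 := by rintro h; rw [h] at c0; simp at c0
    refine ⟨Int.isUnit_iff.mp (IsUnit.of_mul_eq_one _ c0), ?_, ?_, ?_, ?_⟩
    · have := hcol 1; simpa [hN0] using this
    · have := hcol 2; simpa [hN0] using this
    · have := hcol 3; simpa [hN0] using this
    · have := hcol 4; simpa [hN0] using this
  · obtain ⟨i, j, k, hlt⟩ := reduce_any (N 4 0) hb (N 1 0) (N 2 0) (N 3 0)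
    have hEE : matE (-i) (-j) (-k) * matE i j k = 1 := by
      rw [matE_mul, ← matE_zero]; simp
    have hY : YY Γ (M * matE (-i) (-j) (-k) * matW) := by
      refine ih ((matW * (matE i j k * N)) 4 0).natAbs ?_ _ (matW * (matE i j k * N)) ?_
        ((hM.mul (isoJ_E _ _ _)).mul isoJ_W) (isoJ_W.mul ((isoJ_E _ _ _).mul hN)) le_rfl
      · refine lt_of_lt_of_le ?_ hn
        have hv : (matW * (matE i j k * N)) 4 0 = N 0 0 - 6 * i * N 1 0 - 6 * j * N 2 0 +
            2 * k * N 3 0 - (3 * i ^ 2 + 3 * j ^ 2 - k ^ 2) * N 4 0 := by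
          simp [matW, matE, Matrix.mul_apply, Fin.sum_univ_five, vecMul, dotProduct]; ring
        rw [hv]
        set a := N 0 0 - 6 * i * N 1 0 - 6 * j * N 2 0 +
            2 * k * N 3 0 - (3 * i ^ 2 + 3 * j ^ 2 - k ^ 2) * N 4 0 with ha
        have hab : a * N 4 0 = -(3 * (N 1 0 + N 4 0 * i) ^ 2 + 3 * (N 2 0 + N 4 0 * j) ^ 2 -
            (N 3 0 + N 4 0 * k) ^ 2) := by
          rw [ha]; linarith
        rw [← abs_neg, ← hab, abs_mul, ← sq_abs, sq] at hlt
        have := lt_of_mul_lt_mul_right hlt (abs_nonneg _)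
        zify
        exact this
      · calc M * matE (-i) (-j) (-k) * matW * (matW * (matE i j k * N))
            = M * (matE (-i) (-j) (-k) * ((matW * matW) * matE i j k)) * N := by
              simp only [mul_assoc]
          _ = 1 := by rw [matW_mul, one_mul, hEE, mul_one, hMN]
    have hY2 := (hY.W hG ((hM.mul (isoJ_E _ _ _)).mul isoJ_W)).E i j k
    rw [mul_assoc _ matW matW, matW_mul, mul_one, mul_assoc, hEE, mul_one] at hY2
    exact hY2

lemma exists_fix (hG : Good Γ) {M} (hM : IsoJ M) : YY Γ M :=
  euclid hG _ M M⁻¹ (mul_nonsing_inv M hM.unit) hM hM.inv le_rfl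
end group

/-! ### Reduction of the Levi part -/

section group
variable {Γ : Subgroup (GL (Fin 5) ℤ)}

/-- `(α, β, γ)` is the relevant part of the fourth row of an element of `Γ` fixing `e₁`. -/
def RedRow (Γ : Subgroup (GL (Fin 5) ℤ)) (α β γ : ℤ) : Prop :=
  ∃ g, Gm Γ g ∧ g 0 0 = 1 ∧ g 1 0 = 0 ∧ g 2 0 = 0 ∧ g 3 0 = 0 ∧ g 4 0 = 0 ∧
    g 3 1 = α ∧ g 3 2 = β ∧ g 3 3 = γ

lemma RedRow.of_word (hG : Good Γ) (w : List ℕ) (α β γ : ℤ)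
    (h : runW w (bas5 0) = (1, 0, 0, 0, 0) ∧ (runW w (bas5 1)).2.2.2.1 = α ∧
      (runW w (bas5 2)).2.2.2.1 = β ∧ (runW w (bas5 3)).2.2.2.1 = γ) : RedRow Γ α β γ := by
  obtain ⟨g, hg, h'⟩ := Gm.word hG w
  obtain ⟨h0, h1, h2, h3⟩ := h
  have key : ∀ i j, g i j = vec5 (runW w (bas5 j)) i := by
    intro i j
    rw [h', bas5_vec]; simp
  have k3 : ∀ x, vec5 x 3 = x.2.2.2.1 := by rintro ⟨a, b, c, d, e⟩; rfl
  refine ⟨g, hg, ?_, ?_, ?_, ?_, ?_, ?_, ?_, ?_⟩ <;> rw [key]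
  · rw [h0]; rfl
  · rw [h0]; rfl
  · rw [h0]; rfl
  · rw [h0]; rfl
  · rw [h0]; rfl
  · rw [k3, h1]
  · rw [k3, h2]
  · rw [k3, h3]

lemma levi_core (S D u : ℤ) (h1 : D ≤ S) (h2 : -D ≤ S) (hu : 9 ≤ u)
    (h : 3 * S ^ 2 + 3 * D ^ 2 + 1 = u ^ 2) :
    |4 * u - 6 * S - 3 * D| < u ∨ |28 * u - 45 * S + 18 * D| < u ∨
      |49 * u - 60 * S + 60 * D| < u := by
  by_cases c1 : u < 2 * S + D
  · left
    rw [abs_lt]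
    refine ⟨?_, by linarith⟩
    have : 3 * (2 * S + D) < 5 * u := by
      refine lt_of_pow_lt_pow_left₀ 2 (by linarith) ?_
      nlinarith [sq_nonneg (S - 2 * D)]
    linarith
  by_cases c2 : 3 * u < 5 * S - 2 * D
  · right; left
    rw [abs_lt]
    refine ⟨?_, by linarith⟩
    have : 9 * (5 * S - 2 * D) < 29 * u := by
      refine lt_of_pow_lt_pow_left₀ 2 (by linarith) ?_
      nlinarith [sq_nonneg (2 * S + 5 * D)]
    linarith
  by_cases c3 : 4 * u < 5 * (S - D)
  · right; right
    rw [abs_lt]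
    refine ⟨?_, by linarith⟩
    have : 6 * (S - D) < 5 * u := by
      refine lt_of_pow_lt_pow_left₀ 2 (by linarith) ?_
      nlinarith [sq_nonneg (S + D)]
    linarith
  exfalso
  push Not at c1 c2 c3
  have hS : 0 ≤ S := by linarith
  have fin : 75 * (3 * S ^ 2 + 3 * D ^ 2) ≤ 74 * u ^ 2 := by
    by_cases d1 : -S ≤ 5 * D
    · have q : (2 * S + D) ^ 2 ≤ u ^ 2 := pow_le_pow_left₀ (by linarith) c1 2
      nlinarith [mul_nonneg (sub_nonneg.2 h1) (by linarith : 0 ≤ 5 * D + S), mul_nonneg hS (by linarith : 0 ≤ 5 * D + S), mul_nonneg hS (sub_nonneg.2 h1)]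
    · push Not at d1
      by_cases d2 : -5 * S ≤ 7 * D
      · have q : (5 * S - 2 * D) ^ 2 ≤ (3 * u) ^ 2 := pow_le_pow_left₀ (by linarith) c2 2
        nlinarith [mul_nonneg (by linarith : 0 ≤ -5 * D - S) (by linarith : 0 ≤ 7 * D + 5 * S), mul_nonneg hS (by linarith : 0 ≤ 7 * D + 5 * S), mul_nonneg hS (by linarith : 0 ≤ -5 * D - S)]
      · push Not at d2
        have q : (5 * (S - D)) ^ 2 ≤ (4 * u) ^ 2 := pow_le_pow_left₀ (by linarith) c3 2
        nlinarith [mul_nonneg (by linarith : 0 ≤ -7 * D - 5 * S) (by linarith : 0 ≤ D + S), mul_nonneg hS (by linarith : 0 ≤ -7 * D - 5 * S), mul_nonneg hS (by linarith : 0 ≤ D + S)]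
  nlinarith

lemma levi_pos (hG : Good Γ) (s d u : ℤ) (hu : 9 ≤ u) (h : 3 * s ^ 2 + 3 * d ^ 2 + 1 = u ^ 2) :
    ∃ α β γ, RedRow Γ α β γ ∧ |α * s + β * d + γ * u| < u := by
  rcases le_total s d with a | a <;> rcases le_total (-s) d with b | b
  · rcases levi_core d s u a (by linarith) hu (by linarith) with c | c | c
    · exact ⟨-3, -6, 4, RedRow.of_word hG [1, 1, 10] _ _ _
        (by decide +kernel), by convert c using 2; ring⟩
    · exact ⟨18, -45, 28, RedRow.of_word hG [11, 2, 1, 2, 11, 1, 10, 11, 10, 1] _ _ _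
        (by decide +kernel), by convert c using 2; ring⟩
    · exact ⟨60, -60, 49, RedRow.of_word hG [3, 1, 3, 11, 11, 1, 1, 9, 11, 8, 11, 5, 11, 11, 1, 1, 7, 1, 1] _ _ _
        (by decide +kernel), by convert c using 2; ring⟩
  · rcases levi_core (-s) (-d) u (by linarith) (by linarith) hu (by linarith) with c | c | c
    · exact ⟨6, 3, 4, RedRow.of_word hG [1, 11] _ _ _
        (by decide +kernel), by convert c using 2; ring⟩
    · exact ⟨45, -18, 28, RedRow.of_word hG [11, 2, 1, 2, 11, 1, 10, 11, 10, 3, 10] _ _ _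
        (by decide +kernel), by convert c using 2; ring⟩
    · exact ⟨60, -60, 49, RedRow.of_word hG [3, 1, 3, 11, 11, 1, 1, 9, 11, 8, 11, 5, 11, 11, 1, 1, 7, 1, 1] _ _ _
        (by decide +kernel), by convert c using 2; ring⟩
  · rcases levi_core s d u (by linarith) (by linarith) hu (by linarith) with c | c | c
    · exact ⟨-6, -3, 4, RedRow.of_word hG [1, 1, 9, 11, 5, 11, 11, 1, 1, 7, 1, 1] _ _ _
        (by decide +kernel), by convert c using 2; ring⟩
    · exact ⟨-45, 18, 28, RedRow.of_word hG [11, 2, 1, 2, 11, 1, 10, 11, 9, 5, 11, 11, 1, 1, 7, 1, 1] _ _ _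
        (by decide +kernel), by convert c using 2; ring⟩
    · exact ⟨-60, 60, 49, RedRow.of_word hG [3, 1, 3, 11, 11, 1, 1, 9, 11, 9] _ _ _
        (by decide +kernel), by convert c using 2; ring⟩
  · rcases levi_core (-d) (-s) u (by linarith) (by linarith) hu (by linarith) with c | c | c
    · exact ⟨3, 6, 4, RedRow.of_word hG [1, 10, 11, 5, 11, 11, 1, 1, 7, 1, 1] _ _ _
        (by decide +kernel), by convert c using 2; ring⟩
    · exact ⟨-18, 45, 28, RedRow.of_word hG [11, 2, 1, 2, 11, 1, 10, 11, 10, 3, 9, 11, 5, 11, 11, 1, 1, 7, 1, 1] _ _ _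
        (by decide +kernel), by convert c using 2; ring⟩
    · exact ⟨-60, 60, 49, RedRow.of_word hG [3, 1, 3, 11, 11, 1, 1, 9, 11, 9] _ _ _
        (by decide +kernel), by convert c using 2; ring⟩
end group

section group
variable {Γ : Subgroup (GL (Fin 5) ℤ)}

lemma levi_any (hG : Good Γ) (s d u : ℤ) (hu : 9 ≤ |u|) (h : 3 * s ^ 2 + 3 * d ^ 2 + 1 = u ^ 2) :
    ∃ α β γ, RedRow Γ α β γ ∧ |α * s + β * d + γ * u| < |u| := by
  rcases le_total 0 u with h0 | h0
  · rw [abs_of_nonneg h0] at hu ⊢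
    exact levi_pos hG s d u hu h
  · rw [abs_of_nonpos h0] at hu ⊢
    obtain ⟨α, β, γ, h1, h2⟩ := levi_pos hG (-s) (-d) (-u) hu (by linarith)
    refine ⟨α, β, γ, h1, ?_⟩
    rw [← abs_neg]
    convert h2 using 2
    ring

lemma levi_reduce (hG : Good Γ) : ∀ n : ℕ, ∀ M, IsoJ M → FixE M → (M 3 3).natAbs ≤ n →
    ∃ M', GRel Γ M M' ∧ FixE M' ∧ |M' 3 3| ≤ 8 := by
  intro n
  induction n using Nat.strong_induction_on with
  | _ n ih =>
  intro M hM hF hn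
  by_cases h8 : |M 3 3| ≤ 8
  · exact ⟨M, GRel.refl M, hF, h8⟩
  obtain ⟨-, -, -, h43⟩ := hF.last hM
  have e := hM.entry 3 3
  simp [matJ, h43] at e
  obtain ⟨α, β, γ, ⟨g, hg, g0, g1, g2, g3, g4, rfl, rfl, rfl⟩, hlt⟩ :=
    levi_any hG (M 1 3) (M 2 3) (M 3 3) (by omega) (by linarith)
  have hrel := hg.rel M
  have hF' : FixE (g * M) := by
    obtain ⟨f0, f1, f2, f3, f4⟩ := hF
    simp only [FixE, Matrix.mul_apply, Fin.sum_univ_five, f1, f2, f3, f4, g0, g1, g2, g3, g4]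
    simpa using f0
  have h33 : (g * M) 3 3 = g 3 1 * M 1 3 + g 3 2 * M 2 3 + g 3 3 * M 3 3 := by
    simp only [Matrix.mul_apply, Fin.sum_univ_five, h43, g3]; ring
  obtain ⟨M', r, f, b⟩ := ih ((g * M) 3 3).natAbs (by
    refine lt_of_lt_of_le ?_ hn
    rw [h33]
    zify
    exact hlt) (g * M) (hrel.iso hG hM) hF' le_rfl
  exact ⟨M', hrel.trans r, f, b⟩

lemma translate_reduce (hG : Good Γ) {M} (hM : IsoJ M) (hF : FixE M) (h8 : |M 3 3| ≤ 8) :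
    ∃ M', GRel Γ M M' ∧ IsoJ M' ∧ FixE M' ∧ |M' 3 3| ≤ 8 ∧ |M' 1 4| ≤ 18 ∧ |M' 2 4| ≤ 18 ∧
      |M' 3 4| ≤ 18 := by
  obtain ⟨h44, h41, h42, h43⟩ := hF.last hM
  have hc : M 4 4 = 1 ∨ M 4 4 = -1 := by rw [h44]; exact hF.1
  obtain ⟨f0, f1, f2, f3, f4⟩ := id hF
  have hT : Gm Γ (matE (-(M 4 4) * (6 * (M 1 4 / 6))) (-(M 4 4) * (6 * (M 2 4 / 6)))
      (-(M 4 4) * (18 * (M 3 4 / 18)))) := by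
    apply Gm.E_lattice hG <;> rcases hc with h | h <;> rw [h] <;> omega
  have hrel := hT.rel M
  refine ⟨_, hrel, hrel.iso hG hM, ?_, ?_, ?_, ?_, ?_⟩
  · simp only [FixE, Matrix.mul_apply, Fin.sum_univ_five, f1, f2, f3, f4, matE]
    simpa using f0
  · have : ∀ s d u, (matE s d u * M) 3 3 = M 3 3 := by
      intro s d u
      simp [matE, Matrix.mul_apply, Fin.sum_univ_five, h43]
    rw [this]; exact h8
  · have : ∀ s d u, (matE s d u * M) 1 4 = M 1 4 + s * M 4 4 := by
      intro s d u
      simp [matE, Matrix.mul_apply, Fin.sum_univ_five]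
    rw [this, abs_le]
    rcases hc with h | h <;> rw [h] <;> omega
  · have : ∀ s d u, (matE s d u * M) 2 4 = M 2 4 + d * M 4 4 := by
      intro s d u
      simp [matE, Matrix.mul_apply, Fin.sum_univ_five]
    rw [this, abs_le]
    rcases hc with h | h <;> rw [h] <;> omega
  · have : ∀ s d u, (matE s d u * M) 3 4 = M 3 4 + u * M 4 4 := by
      intro s d u
      simp [matE, Matrix.mul_apply, Fin.sum_univ_five]
    rw [this, abs_le]
    rcases hc with h | h <;> rw [h] <;> omega

lemma levi_cauchy {s d u s1 d1 u1 : ℤ} (hu : |u| ≤ 8) (h : 3 * s ^ 2 + 3 * d ^ 2 + 1 = u ^ 2)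
    (h1 : 3 * s1 ^ 2 + 3 * d1 ^ 2 - u1 ^ 2 = 3) (h2 : 3 * s * s1 + 3 * d * d1 = u * u1) :
    |s1| ≤ 18 ∧ |d1| ≤ 18 ∧ |u1| ≤ 18 := by
  have hu2 : u ^ 2 ≤ 8 ^ 2 := sq_le_sq' (by linarith [(abs_le.1 hu).1]) (abs_le.1 hu).2
  have key : u1 ^ 2 ≤ 3 * (u ^ 2 - 1) := by
    have e : u ^ 2 * u1 ^ 2 + 9 * (s * d1 - d * s1) ^ 2 = (u ^ 2 - 1) * (u1 ^ 2 + 3) := by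
      have : u ^ 2 * u1 ^ 2 = (3 * s * s1 + 3 * d * d1) ^ 2 := by rw [h2]; ring
      rw [this, ← h, show u1 ^ 2 = 3 * s1 ^ 2 + 3 * d1 ^ 2 - 3 by linarith]; ring
    nlinarith [sq_nonneg (s * d1 - d * s1)]
  have a : u1 ^ 2 ≤ 18 ^ 2 := by linarith
  refine ⟨abs_le_of_sq_le_sq (by nlinarith [sq_nonneg d1]) (by norm_num),
    abs_le_of_sq_le_sq (by nlinarith [sq_nonneg s1]) (by norm_num),
    abs_le_of_sq_le_sq a (by norm_num)⟩

lemma prod_bound {x y : ℤ} (hx : |x| ≤ 18) (hy : |y| ≤ 18) : -324 ≤ x * y ∧ x * y ≤ 324 := by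
  rw [← abs_le, abs_mul]
  calc |x| * |y| ≤ 18 * 18 := by gcongr
    _ = 324 := by norm_num

set_option maxHeartbeats 1000000 in
lemma bound_entries {M} (hM : IsoJ M) (hF : FixE M) (h8 : |M 3 3| ≤ 8) (h1 : |M 1 4| ≤ 18)
    (h2 : |M 2 4| ≤ 18) (h3 : |M 3 4| ≤ 18) : ∀ i j, |M i j| ≤ 10000 := by
  obtain ⟨h44, h41, h42, h43⟩ := hF.last hM
  have hc : M 4 4 = 1 ∨ M 4 4 = -1 := by rw [h44]; exact hF.1
  obtain ⟨f0, f1, f2, f3, f4⟩ := hF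
  have e33 := hM.entry 3 3
  have e13 := hM.entry 3 1
  have e23 := hM.entry 3 2
  have e11 := hM.entry 1 1
  have e22 := hM.entry 2 2
  have e14 := hM.entry 1 4
  have e24 := hM.entry 2 4
  have e34 := hM.entry 3 4
  have e44 := hM.entry 4 4
  simp [matJ, h41, h42, h43] at e33 e13 e23 e11 e22 e14 e24 e34 e44
  have hp : 3 * M 1 3 ^ 2 + 3 * M 2 3 ^ 2 + 1 = M 3 3 ^ 2 := by linarith
  obtain ⟨b11, b21, b31⟩ := levi_cauchy h8 hp (s1 := M 1 1) (d1 := M 2 1) (u1 := M 3 1)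
    (by linarith) (by linarith)
  obtain ⟨b12, b22, b32⟩ := levi_cauchy h8 hp (s1 := M 1 2) (d1 := M 2 2) (u1 := M 3 2)
    (by linarith) (by linarith)
  have hu2 : M 3 3 ^ 2 ≤ 8 ^ 2 := sq_le_sq' (by linarith [(abs_le.1 h8).1]) (abs_le.1 h8).2
  have b13 : |M 1 3| ≤ 18 :=
    abs_le_of_sq_le_sq (by nlinarith [sq_nonneg (M 2 3)]) (by norm_num)
  have b23 : |M 2 3| ≤ 18 :=
    abs_le_of_sq_le_sq (by nlinarith [sq_nonneg (M 1 3)]) (by norm_num)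
  have b33 : |M 3 3| ≤ 18 := by linarith
  have row : ∀ x a b c : ℤ, |a| ≤ 18 → |b| ≤ 18 → |c| ≤ 18 →
      x * M 4 4 + 6 * a * M 1 4 + 6 * b * M 2 4 - 2 * c * M 3 4 = 0 → |x| ≤ 10000 := by
    intro x a b c ha hb hc' hx
    have q1 := prod_bound ha h1
    have q2 := prod_bound hb h2
    have q3 := prod_bound hc' h3
    rw [abs_le]
    rcases hc with h | h <;> rw [h] at hx <;> constructor <;> linarith
  have r1 := row _ _ _ _ b11 b21 b31 e14
  have r2 := row _ _ _ _ b12 b22 b32 e24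
  have r3 := row _ _ _ _ b13 b23 b33 e34
  have r4 : |M 0 4| ≤ 10000 := by
    have q1 := prod_bound h1 h1
    have q2 := prod_bound h2 h2
    have q3 := prod_bound h3 h3
    rw [abs_le]
    rcases hc with h | h <;> rw [h] at e44 <;> constructor <;> linarith
  have r0 : |M 0 0| ≤ 10000 := by rcases f0 with h | h <;> rw [h] <;> norm_num
  have c4 : |M 4 4| ≤ 10000 := by rcases hc with h | h <;> rw [h] <;> norm_num
  have z : ∀ x : ℤ, x = 0 → |x| ≤ 10000 := by rintro x rfl; norm_num
  have l : ∀ x : ℤ, |x| ≤ 18 → |x| ≤ 10000 := fun x hx => by linarith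
  intro i j
  fin_cases i <;> fin_cases j
  exacts [r0, r1, r2, r3, r4, z _ f1, l _ b11, l _ b12, l _ b13, l _ h1, z _ f2, l _ b21, l _ b22,
    l _ b23, l _ h2, z _ f3, l _ b31, l _ b32, l _ b33, l _ h3, z _ f4, z _ h41, z _ h42, z _ h43,
    c4]

lemma all_reduce (hG : Good Γ) {M} (hM : IsoJ M) :
    ∃ M', GRel Γ M M' ∧ ∀ i j, |M' i j| ≤ 10000 := by
  obtain ⟨M1, r1, f1⟩ := exists_fix hG hM
  have i1 := r1.iso hG hM
  obtain ⟨M2, r2, f2, b2⟩ := levi_reduce hG _ M1 i1 f1 le_rfl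
  have i2 := r2.iso hG i1
  obtain ⟨M3, r3, i3, f3, b3, c1, c2, c3⟩ := translate_reduce hG i2 f2 b2
  exact ⟨M3, (r1.trans r2).trans r3, bound_entries i3 f3 b3 c1 c2 c3⟩

/-! ### Finite index -/

lemma finite_bounded : Finite {M : Matrix (Fin 5) (Fin 5) ℤ // ∀ i j, |M i j| ≤ 10000} := by
  refine Finite.of_injective
    (β := Fin 5 → Fin 5 → Set.Icc (-10000 : ℤ) 10000)
    (fun M i j => ⟨M.1 i j, abs_le.1 (M.2 i j)⟩) ?_
  intro M N h
  apply Subtype.ext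
  ext i j
  have := congrFun (congrFun h i) j
  exact congrArg Subtype.val this

lemma finite_index (hG : Good Γ) :
    (Γ.subgroupOf (orthogonalSubgroup matQ)).FiniteIndex := by
  have key : ∀ h : orthogonalSubgroup matQ, ∃ M : {M : Matrix (Fin 5) (Fin 5) ℤ //
      ∀ i j, |M i j| ≤ 10000}, ∃ γ ∈ Γ,
      ((γ * (h : GL (Fin 5) ℤ)⁻¹ : GL (Fin 5) ℤ) : Matrix (Fin 5) (Fin 5) ℤ) * matP
        = matP * M.1 := by
    intro h
    obtain ⟨g, hg, hi⟩ := orth_integral (inv_mem h.2)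
    obtain ⟨M', ⟨γ, hγ, e⟩, hb⟩ := all_reduce hG hi
    refine ⟨⟨M', hb⟩, γ, hγ, ?_⟩
    rw [Units.val_mul, mul_assoc, hg, e]
  choose φ hφ using key
  have hfin := finite_bounded
  have : Finite (orthogonalSubgroup matQ ⧸ Γ.subgroupOf (orthogonalSubgroup matQ)) := by
    refine Finite.of_injective (fun q => φ q.out) ?_
    intro q r hqr
    simp only at hqr
    obtain ⟨a, ha, ea⟩ := hφ q.out
    obtain ⟨b, hb, eb⟩ := hφ r.out
    rw [hqr, ← eb] at ea
    have e : a * ((q.out : orthogonalSubgroup matQ) : GL (Fin 5) ℤ)⁻¹ =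
        b * ((r.out : orthogonalSubgroup matQ) : GL (Fin 5) ℤ)⁻¹ :=
      Units.ext (matP_cancel_right ea)
    rw [← q.out_eq', ← r.out_eq']
    apply QuotientGroup.eq.2
    rw [Subgroup.mem_subgroupOf]
    have : (((q.out)⁻¹ * r.out : orthogonalSubgroup matQ) : GL (Fin 5) ℤ) = a⁻¹ * b := by
      have e2 : ((q.out : orthogonalSubgroup matQ) : GL (Fin 5) ℤ)⁻¹ =
        a⁻¹ * (b * ((r.out : orthogonalSubgroup matQ) : GL (Fin 5) ℤ)⁻¹) := by
        rw [← e]; group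
      simp only [Subgroup.coe_mul, Subgroup.coe_inv, e2]
      group
    rw [this]
    exact Γ.mul_mem (Γ.inv_mem ha) hb
  exact Subgroup.finiteIndex_of_finite_quotient
end group

/-- Case 21 of Theorem 1.2: the hypergeometric group `Γ(f,g)` generated by the companion matrices `A`, `B`
of `f(x) = x^5 - x^4 - x^3 + x^2 + x - 1` and `g(x) = x^5 + 2*x^4 + 3*x^3 + 3*x^2 + 2*x + 1`
is an arithmetic subgroup of `O_Q(ℤ)`: it preserves `Q`, it is contained in `O_Q(ℤ)`,
and it has finite index in `O_Q(ℤ)`. -/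
theorem hypergeometric_group_arithmetic
    (A B : GL (Fin 5) ℤ)
    (hA : (A : Matrix (Fin 5) (Fin 5) ℤ) = matA)
    (hB : (B : Matrix (Fin 5) (Fin 5) ℤ) = matB) :
    matAᵀ * matQ * matA = matQ ∧
    matBᵀ * matQ * matB = matQ ∧
    Subgroup.closure {A, B} ≤ orthogonalSubgroup matQ ∧
    ((Subgroup.closure {A, B}).subgroupOf (orthogonalSubgroup matQ)).FiniteIndex := by
  have eA : matAᵀ * matQ * matA = matQ := by decide +kernel
  have eB : matBᵀ * matQ * matB = matQ := by decide +kernel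
  have hle : Subgroup.closure {A, B} ≤ orthogonalSubgroup matQ := by
    rw [Subgroup.closure_le]
    rintro x (rfl | rfl)
    · show (x : Matrix (Fin 5) (Fin 5) ℤ)ᵀ * matQ * (x : Matrix (Fin 5) (Fin 5) ℤ) = matQ
      rw [hA, eA]
    · show (x : Matrix (Fin 5) (Fin 5) ℤ)ᵀ * matQ * (x : Matrix (Fin 5) (Fin 5) ℤ) = matQ
      rw [hB, eB]
  refine ⟨eA, eB, hle, finite_index ⟨⟨A, ?_, hA⟩, ⟨B, ?_, hB⟩, hle⟩⟩
  · exact Subgroup.subset_closure (by simp)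
  · exact Subgroup.subset_closure (by simp)
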